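/- arXiv:1007.3239 — 2 statements merged into one kernel-verified Lean document; each statement's English description precedes it below -/
import Mathlib

section
/- Let R(n) be the number of n×n permutation matrices that are 90°-symmetric. Then R(1) = 1, R(2) = 0, R(4) = 2, R(n) = R(n−1) for every odd n ≥ 3, and R(n) = (n−2)·R(n−4) for every even n ≥ 6. -/
open Matrix

/-- The `n × n` reverse matrix `J`: (1-indexed) `J i j = 1` iff `i + j = n + 1`. -/
def revMat (n : ℕ) : Matrix (Fin n) (Fin n) ℝ :=
  Matrix.of fun i j => if (i : ℕ) + (j : ℕ) + 1 = n then 1 else 0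

/-- The `n × n` all-ones matrix `E`. -/
def allOnes (n : ℕ) : Matrix (Fin n) (Fin n) ℝ :=
  Matrix.of fun _ _ => 1

/-- `A` is a magic square with magic number `μ`: all rows, all columns, the main
diagonal and the minor diagonal sum to `μ`. -/
def IsMagic {n : ℕ} (A : Matrix (Fin n) (Fin n) ℝ) (μ : ℝ) : Prop :=
  (∀ i, ∑ j, A i j = μ) ∧ (∀ j, ∑ i, A i j = μ) ∧
    A.trace = μ ∧ (revMat n * A).trace = μ

/-- `A` is a semi-magic square with magic number `μ`: all rows and columns sum to `μ`. -/
def IsSemiMagic {n : ℕ} (A : Matrix (Fin n) (Fin n) ℝ) (μ : ℝ) : Prop :=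
  (∀ i, ∑ j, A i j = μ) ∧ (∀ j, ∑ i, A i j = μ)

/-- `P` is a permutation matrix: a 0–1 matrix with exactly one 1 in each row and column. -/
def IsPermMat {n : ℕ} (P : Matrix (Fin n) (Fin n) ℝ) : Prop :=
  (∀ i j, P i j = 0 ∨ P i j = 1) ∧ (∀ i, ∃! j, P i j = 1) ∧ (∀ j, ∃! i, P i j = 1)

/-- A square matrix is bisymmetric if it is symmetric and persymmetric. -/
def IsBisym {n : ℕ} (P : Matrix (Fin n) (Fin n) ℝ) : Prop :=
  P = Pᵀ ∧ revMat n * P = (revMat n * P)ᵀ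

/-- A square matrix is 90°-symmetric if `Pᵀ = J * P`. -/
def IsRot90 {n : ℕ} (P : Matrix (Fin n) (Fin n) ℝ) : Prop :=
  Pᵀ = revMat n * P

/-- A magic classifying permutation matrix (MCPM): a symmetric permutation matrix with
trace 0 when `n` is even; when `n` is odd, the middle diagonal entry is 1 and the trace is 1. -/
def IsMCPM {n : ℕ} (P : Matrix (Fin n) (Fin n) ℝ) : Prop :=
  IsPermMat P ∧ P = Pᵀ ∧
    ((Even n ∧ P.trace = 0) ∨
      (Odd n ∧ P.trace = 1 ∧ ∀ i : Fin n, (i : ℕ) = n / 2 → P i i = 1))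

/-- `A` is a natural magic square matrix: its entries are a rearrangement of `1, …, n²`. -/
def IsNatural {n : ℕ} (A : Matrix (Fin n) (Fin n) ℝ) : Prop :=
  Function.Injective (fun p : Fin n × Fin n => A p.1 p.2) ∧
    ∀ i j, ∃ k : Fin (n * n), A i j = (k : ℝ) + 1


section InvolutionRoots

variable {α : Type*} [DecidableEq α]

/-- The map that is the identity on the orbits of `a` and `b` under `r`, and `r` elsewhere. -/
def fixOrbits (r : α → α) (a b : α) (f : α → α) (x : α) : α :=
  if x = a ∨ x = b ∨ x = r a ∨ x = r b then x else f x

/-- The map that is the cycle `a → b → r a → r b → a` on these points, and `f` elsewhere. -/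
def insertCycle (r : α → α) (a b : α) (f : α → α) (x : α) : α :=
  if x = a then b else if x = b then r a else if x = r a then r b else if x = r b then a else f x

/-- The number of square roots of a fixed-point-free involution on `k` points. -/
def rootCount (k : ℕ) : ℕ :=
  if k = 0 then 1 else if k < 4 then 0 else (k - 2) * rootCount (k - 4)

theorem fixOrbits_involutive {r : α → α} (hr : Function.Involutive r) (a b : α) :
    Function.Involutive (fixOrbits r a b r) := by
  intro x
  have h1 := hr x
  have h2 := hr a
  have h3 := hr b
  unfold fixOrbits
  grind

variable [Fintype α]

/-- The points moved by `r`. -/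
def movedPoints (r : α → α) : Finset α := Finset.univ.filter fun x => r x ≠ x

/-- The compositional square roots of `r` that fix every fixed point of `r`. -/
def rootsFixing (r : α → α) : Finset (α → α) :=
  Finset.univ.filter fun t => (∀ x, t (t x) = r x) ∧ ∀ x, r x = x → t x = x

theorem movedPoints_fixOrbits {r : α → α} (a b : α) :
    movedPoints (fixOrbits r a b r) = movedPoints r \ {a, b, r a, r b} := by
  ext x
  simp only [movedPoints, fixOrbits, Finset.mem_filter, Finset.mem_univ, true_and,
    Finset.mem_sdiff, Finset.mem_insert, Finset.mem_singleton]
  grind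

theorem card_orbits {r : α → α} (hr : Function.Involutive r) {a b : α}
    (ha : a ∈ movedPoints r) (hb : b ∈ movedPoints r \ {a, r a}) :
    ({a, b, r a, r b} : Finset α).card = 4 ∧ {a, b, r a, r b} ⊆ movedPoints r := by
  have h2 := hr a
  have h3 := hr b
  simp only [movedPoints, Finset.mem_filter, Finset.mem_univ, true_and,
    Finset.mem_sdiff, Finset.mem_insert, Finset.mem_singleton] at ha hb
  constructor
  · rw [Finset.card_insert_of_notMem, Finset.card_insert_of_notMem,
      Finset.card_insert_of_notMem, Finset.card_singleton] <;>
    · simp only [Finset.mem_insert, Finset.mem_singleton]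
      grind
  · intro x
    simp only [movedPoints, Finset.mem_filter, Finset.mem_univ, true_and,
      Finset.mem_insert, Finset.mem_singleton]
    grind

theorem card_rootsFixing_fiber {r : α → α} (hr : Function.Involutive r) {a b : α}
    (ha : a ∈ movedPoints r) (hb : b ∈ movedPoints r \ {a, r a}) :
    ((rootsFixing r).filter fun t => t a = b).card =
      (rootsFixing (fixOrbits r a b r)).card := by
  have h2 := hr a
  have h3 := hr b
  simp only [movedPoints, Finset.mem_filter, Finset.mem_univ, true_and,
    Finset.mem_sdiff, Finset.mem_insert, Finset.mem_singleton, not_or] at ha hb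
  obtain ⟨hb, hba, hbra⟩ := hb
  refine Finset.card_bij' (fun t _ => fixOrbits r a b t) (fun t _ => insertCycle r a b t)
    ?_ ?_ ?_ ?_
  · intro t ht
    simp only [rootsFixing, Finset.mem_filter, Finset.mem_univ, true_and] at ht ⊢
    obtain ⟨⟨ht, hfix⟩, hab⟩ := ht
    have e1 : t b = r a := by rw [← hab, ht]
    have e2 : t (r a) = r b := by rw [← e1, ht]
    have e3 : t (r b) = a := by rw [← e2, ht, h2]
    have hinj : Function.Injective t := fun x y h => hr.injective (by rw [← ht, ← ht, h])
    have hA : ∀ x, t x = a ∨ t x = b ∨ t x = r a ∨ t x = r b →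
        x = a ∨ x = b ∨ x = r a ∨ x = r b := by
      intro x hx
      rcases hx with h | h | h | h
      · exact .inr (.inr (.inr (hinj (h.trans e3.symm))))
      · exact .inl (hinj (h.trans hab.symm))
      · exact .inr (.inl (hinj (h.trans e1.symm)))
      · exact .inr (.inr (.inl (hinj (h.trans e2.symm))))
    constructor
    · intro x
      have := ht x
      have := hA x
      unfold fixOrbits
      grind
    · intro x hx
      have := hfix x
      unfold fixOrbits at hx ⊢
      grind
  · intro t ht
    simp only [rootsFixing, Finset.mem_filter, Finset.mem_univ, true_and] at ht ⊢
    obtain ⟨ht, hfix⟩ := ht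
    have hA : ∀ x, x = a ∨ x = b ∨ x = r a ∨ x = r b → t x = x := by
      intro x hx
      apply hfix
      simp [fixOrbits, hx]
    have hinj : Function.Injective t := fun x y h =>
      (fixOrbits_involutive hr a b).injective (by rw [← ht, ← ht, h])
    have hout : ∀ x, t x = a ∨ t x = b ∨ t x = r a ∨ t x = r b → t x = x :=
      fun x hx => hinj (hA (t x) hx)
    refine ⟨⟨fun x => ?_, fun x hx => ?_⟩, by simp [insertCycle]⟩
    · have e := ht x
      have := hA x
      have := hout x
      unfold fixOrbits at e
      unfold insertCycle
      grind
    · have e := hfix x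
      unfold fixOrbits at e
      unfold insertCycle
      grind
  · intro t ht
    simp only [rootsFixing, Finset.mem_filter, Finset.mem_univ, true_and] at ht ⊢
    obtain ⟨⟨ht, -⟩, hab⟩ := ht
    have e1 : t b = r a := by rw [← hab, ht]
    have e2 : t (r a) = r b := by rw [← e1, ht]
    have e3 : t (r b) = a := by rw [← e2, ht, h2]
    funext x
    unfold insertCycle fixOrbits
    grind
  · intro t ht
    simp only [rootsFixing, Finset.mem_filter, Finset.mem_univ, true_and] at ht ⊢
    have hA : ∀ x, x = a ∨ x = b ∨ x = r a ∨ x = r b → t x = x := by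
      intro x hx
      apply ht.2
      simp [fixOrbits, hx]
    funext x
    unfold insertCycle fixOrbits
    grind

theorem card_rootsFixing {r : α → α} (hr : Function.Involutive r) :
    (rootsFixing r).card = rootCount (movedPoints r).card := by
  induction hk : (movedPoints r).card using Nat.strong_induction_on generalizing r with
  | _ k ih =>
  rw [rootCount]
  split_ifs with h0 h4
  · subst h0
    rw [Finset.card_eq_zero, movedPoints, Finset.filter_eq_empty_iff] at hk
    simp only [Finset.mem_univ, ne_eq, not_not, true_imp_iff] at hk
    rw [Finset.card_eq_one]
    refine ⟨id, ?_⟩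
    ext t
    simp only [rootsFixing, Finset.mem_filter, Finset.mem_univ, true_and, Finset.mem_singleton,
      hk, true_imp_iff]
    constructor
    · rintro ⟨-, h⟩
      exact funext h
    · rintro rfl
      simp
  all_goals
    obtain ⟨a, ha⟩ : (movedPoints r).Nonempty := by
      rw [← Finset.card_pos]
      lia
    have hmaps : ∀ t ∈ rootsFixing r, t a ∈ movedPoints r \ {a, r a} := by
      intro t ht
      simp only [rootsFixing, movedPoints, Finset.mem_filter, Finset.mem_univ, true_and,
        Finset.mem_sdiff, Finset.mem_insert, Finset.mem_singleton] at ht ha ⊢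
      have h1 := ht.1 a
      have h2 := ht.1 (t a)
      have h3 := ht.1 (t (t a))
      have h4 := hr a
      grind
    rw [Finset.card_eq_sum_card_fiberwise hmaps]
  · refine Finset.sum_eq_zero fun b hb => ?_
    have h := card_orbits hr ha hb
    have := Finset.card_le_card h.2
    lia
  · have hsum : ∀ b ∈ movedPoints r \ {a, r a},
        ((rootsFixing r).filter fun t => t a = b).card = rootCount (k - 4) := by
      intro b hb
      have h := card_orbits hr ha hb
      rw [card_rootsFixing_fiber hr ha hb]
      refine ih _ (by lia) (fixOrbits_involutive hr a b) ?_
      rw [movedPoints_fixOrbits, Finset.card_sdiff_of_subset h.2, hk, h.1]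
    rw [Finset.sum_congr rfl hsum, Finset.sum_const, smul_eq_mul]
    congr 1
    have hra : r a ≠ a := by simpa [movedPoints] using ha
    rw [Finset.card_sdiff_of_subset, hk, Finset.card_pair hra.symm]
    intro x
    have := hr a
    simp only [movedPoints, Finset.mem_filter, Finset.mem_univ, true_and,
      Finset.mem_insert, Finset.mem_singleton]
    grind

end InvolutionRoots

theorem card_movedPoints_rev (n : ℕ) :
    (movedPoints (Fin.rev : Fin n → Fin n)).card = 2 * (n / 2) := by
  rcases Nat.even_or_odd' n with ⟨m, rfl | rfl⟩
  · rw [movedPoints, Finset.filter_true_of_mem, Finset.card_univ, Fintype.card_fin]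
    · lia
    · intro x _ h
      have := congrArg Fin.val h
      rw [Fin.val_rev] at this
      lia
  · have : movedPoints (Fin.rev : Fin (2 * m + 1) → Fin (2 * m + 1)) =
        Finset.univ.erase ⟨m, by lia⟩ := by
      ext x
      simp only [movedPoints, Finset.mem_filter, Finset.mem_univ, true_and, Finset.mem_erase,
        and_true, ne_eq, Fin.ext_iff, Fin.val_rev]
      lia
    rw [this, Finset.card_erase_of_mem (Finset.mem_univ _), Finset.card_univ, Fintype.card_fin]
    lia

theorem mem_rootsFixing_rev {n : ℕ} (t : Fin n → Fin n) :
    t ∈ rootsFixing Fin.rev ↔ ∀ x, t (t x) = Fin.rev x := by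
  simp only [rootsFixing, Finset.mem_filter, Finset.mem_univ, true_and, and_iff_left_iff_imp]
  intro h x hx
  have h1 : Fin.rev (t x) = t x := by rw [← h (t x), h x, hx]
  have h2 := congrArg Fin.val h1
  have h3 := congrArg Fin.val hx
  rw [Fin.val_rev] at h2 h3
  ext
  lia

theorem revMat_mul_apply {n : ℕ} (P : Matrix (Fin n) (Fin n) ℝ) (i j : Fin n) :
    (revMat n * P) i j = P (Fin.rev i) j := by
  rw [Matrix.mul_apply, Finset.sum_eq_single (Fin.rev i)]
  · have : (i : ℕ) + (Fin.rev i : ℕ) + 1 = n := by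
      rw [Fin.val_rev]
      lia
    simp only [revMat, Matrix.of_apply, if_pos this, one_mul]
  · intro k _ hk
    have : ¬ (i : ℕ) + (k : ℕ) + 1 = n := by
      intro h
      apply hk
      ext
      rw [Fin.val_rev]
      lia
    simp only [revMat, Matrix.of_apply, if_neg this, zero_mul]
  · simp

theorem isRot90_iff {n : ℕ} (P : Matrix (Fin n) (Fin n) ℝ) :
    IsRot90 P ↔ ∀ i j, P j i = P (Fin.rev i) j := by
  simp only [IsRot90, ← Matrix.ext_iff, Matrix.transpose_apply, revMat_mul_apply]

theorem ncard_rot90_perm (n : ℕ) :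
    Set.ncard {P : Matrix (Fin n) (Fin n) ℝ | IsPermMat P ∧ IsRot90 P} =
      rootCount (2 * (n / 2)) := by
  rw [← card_movedPoints_rev, ← card_rootsFixing Fin.rev_involutive, ← Set.ncard_coe_finset]
  symm
  refine Set.ncard_congr
    (fun t _ => Matrix.of fun i j => if Fin.rev (t i) = j then (1 : ℝ) else 0) ?_ ?_ ?_
  · intro t ht
    rw [Finset.mem_coe, mem_rootsFixing_rev] at ht
    have hrev : ∀ x, t (Fin.rev x) = Fin.rev (t x) := fun x => by rw [← ht, ht]
    have key : ∀ i j, Fin.rev (t j) = i ↔ t i = j := by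
      intro i j
      constructor
      · rintro rfl
        rw [hrev, ht, Fin.rev_rev]
      · rintro rfl
        rw [ht, Fin.rev_rev]
    refine ⟨⟨fun i j => ?_, fun i => ?_, fun j => ?_⟩, (isRot90_iff _).2 fun i j => ?_⟩
    · simp only [Matrix.of_apply]
      split_ifs <;> simp
    · exact ⟨Fin.rev (t i), by simp, fun j hj => by simpa [eq_comm] using hj⟩
    · refine ⟨t j, by simp [ht], fun i hi => ?_⟩
      have : Fin.rev (t i) = j := by simpa using hi
      exact ((key j i).1 this).symm
    · simp only [Matrix.of_apply, hrev, Fin.rev_rev]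
      simp only [key]
  · intro s t _ _ h
    funext i
    have := congrFun (congrFun h i) (Fin.rev (t i))
    simpa using this
  · rintro P ⟨⟨h01, hrow, hcol⟩, hrot⟩
    rw [isRot90_iff] at hrot
    choose s hs hu using hrow
    have hP : ∀ i j, P i j = 1 ↔ s i = j := fun i j =>
      ⟨fun h => (hu i j h).symm, fun h => h ▸ hs i⟩
    refine ⟨fun i => Fin.rev (s i), ?_, ?_⟩
    · rw [Finset.mem_coe, mem_rootsFixing_rev]
      intro x
      congr 1
      rw [← hP, ← hrot, hP]
    · ext i j
      rw [Matrix.of_apply, Fin.rev_rev]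
      split_ifs with h
      · exact ((hP i j).2 h).symm
      · exact ((h01 i j).resolve_right (mt (hP i j).1 h)).symm

/-- the count of 90°-symmetric permutation matrices. -/
theorem count_rot90_perm (R : ℕ → ℕ)
    (hR : ∀ n, R n = Set.ncard {P : Matrix (Fin n) (Fin n) ℝ | IsPermMat P ∧ IsRot90 P}) :
    R 1 = 1 ∧ R 2 = 0 ∧ R 4 = 2 ∧
    (∀ n, 3 ≤ n → Odd n → R n = R (n - 1)) ∧
    (∀ n, 6 ≤ n → Even n → R n = (n - 2) * R (n - 4)) := by
  simp only [hR, ncard_rot90_perm]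
  refine ⟨by simp [rootCount], by simp [rootCount], by simp [rootCount], ?_, ?_⟩
  · rintro n hn ⟨m, rfl⟩
    congr 1
    lia
  · rintro n hn ⟨m, rfl⟩
    rw [rootCount, if_neg (by lia), if_neg (by lia)]
    congr 2 <;> lia
end

section
/- Let A be a magic square of order 2n with magic number μ, and suppose A is a type B magic square, i.e., there is an MCPM P of order 2n with A + P·A = (2μ/(2n))·E or A + A·P = (2μ/(2n))·E. Then A is singular (det(A) = 0), and moreover rank(A) ≤ n + 1. -/
open Matrix

namespace Matrix

/-- The rank of a sum of matrices is at most the sum of the ranks. -/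
theorem rank_add_le_rank_add_rank {m n K : Type*} [Fintype m] [Fintype n] [Field K]
    (A B : Matrix m n K) : (A + B).rank ≤ A.rank + B.rank := by
  unfold Matrix.rank
  rw [Matrix.mulVecLin_add]
  exact (Submodule.finrank_mono (LinearMap.range_add_le _ _)).trans
    (Submodule.finrank_add_le_finrank_add_finrank _ _)

/-- The rank of an idempotent matrix over a field is its trace. -/
theorem rank_eq_trace_of_isIdempotentElem {ι K : Type*} [Fintype ι] [DecidableEq ι] [Field K]
    {Q : Matrix ι ι K} (hQ : IsIdempotentElem Q) : (Q.rank : K) = Q.trace := by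
  have h : IsIdempotentElem (Matrix.toLin' Q) := by
    rw [IsIdempotentElem, Module.End.mul_eq_comp, ← Matrix.toLin'_mul, hQ.eq]
  rw [← Matrix.trace_toLin'_eq, (LinearMap.IsIdempotentElem.isProj_range _ h).trace]
  rfl

end Matrix

/-- A symmetric permutation matrix is an involution. -/
theorem IsPermMat.mul_self_of_symm {n : ℕ} {P : Matrix (Fin n) (Fin n) ℝ} (hP : IsPermMat P)
    (hs : P = Pᵀ) : P * P = 1 := by
  obtain ⟨h01, hrow, hcol⟩ := hP
  ext i k
  obtain ⟨j, hj, hju⟩ := hrow i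
  have hzero : ∀ l, l ≠ j → P i l = 0 := fun l hl =>
    (h01 i l).resolve_right fun h => hl (hju l h)
  have hji : P j i = 1 := by rw [hs]; exact hj
  rw [mul_apply, Finset.sum_eq_single j (fun l _ hl => by rw [hzero l hl, zero_mul]) (by simp),
    hj, one_mul]
  by_cases hik : i = k
  · rw [← hik, hji, one_apply_eq]
  · rw [one_apply_ne hik]
    exact (h01 j k).resolve_right fun h => hik ((hrow j).unique hji h)

theorem rank_smul_allOnes_le (n : ℕ) (c : ℝ) : (c • allOnes n).rank ≤ 1 := by
  have h : c • allOnes n = vecMulVec (fun _ => c) (fun _ => 1) := by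
    ext i j
    simp [allOnes, vecMulVec_apply]
  rw [h]
  exact rank_vecMulVec_le _ _

/-- If `P` is a traceless involution of order `2n` and `A + P * A` is a multiple of the
all-ones matrix, then `A` has rank at most `n + 1`. -/
theorem rank_le_of_add_involution_mul {n : ℕ} {A P : Matrix (Fin (2 * n)) (Fin (2 * n)) ℝ}
    {c : ℝ} (hP : P * P = 1) (htr : P.trace = 0) (h : A + P * A = c • allOnes (2 * n)) :
    A.rank ≤ n + 1 := by
  set Q : Matrix (Fin (2 * n)) (Fin (2 * n)) ℝ := (1 / 2 : ℝ) • (1 - P) with hQ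
  have hidem : IsIdempotentElem Q := by
    rw [IsIdempotentElem, hQ, smul_mul_smul_comm, sub_mul, mul_sub, mul_sub, hP]
    simp only [one_mul, mul_one]
    module
  have hrank : Q.rank = n := by
    have := rank_eq_trace_of_isIdempotentElem hidem
    rw [hQ, trace_smul, trace_sub, htr, trace_one, Fintype.card_fin, ← hQ] at this
    push_cast [smul_eq_mul] at this
    exact_mod_cast (show (Q.rank : ℝ) = n by linarith)
  have hA : A = Q * A + (c / 2) • allOnes (2 * n) := by
    rw [div_eq_inv_mul, mul_smul, ← h, hQ, smul_mul_assoc, sub_mul, one_mul]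
    module
  calc A.rank = (Q * A + (c / 2) • allOnes (2 * n)).rank := by rw [← hA]
    _ ≤ (Q * A).rank + ((c / 2) • allOnes (2 * n)).rank := rank_add_le_rank_add_rank _ _
    _ ≤ n + 1 := add_le_add ((rank_mul_le_left _ _).trans hrank.le) (rank_smul_allOnes_le _ _)

/-- A magic square of order two is constant, hence singular. -/
theorem IsMagic.det_eq_zero_of_order_two {A : Matrix (Fin 2) (Fin 2) ℝ} {μ : ℝ}
    (hA : IsMagic A μ) : A.det = 0 := by
  obtain ⟨hrow, hcol, htr, -⟩ := hA
  have hr0 := hrow 0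
  have hr1 := hrow 1
  have hc0 := hcol 0
  rw [trace_fin_two] at htr
  simp only [Fin.sum_univ_two] at hr0 hr1 hc0
  have h01 : A 0 1 = A 0 0 := by linarith
  have h10 : A 1 0 = A 0 0 := by linarith
  have h11 : A 1 1 = A 0 0 := by linarith
  rw [det_fin_two, h01, h10, h11, sub_self]

/-- a type B magic square of order `2n` is singular with rank at most `n + 1`. -/
theorem typeB_singular {n : ℕ} (hn : 0 < n)
    (A : Matrix (Fin (2 * n)) (Fin (2 * n)) ℝ) (μ : ℝ) (hA : IsMagic A μ)
    (htype : ∃ P : Matrix (Fin (2 * n)) (Fin (2 * n)) ℝ, IsMCPM P ∧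
      (A + P * A = (2 * μ / ((2 * n : ℕ) : ℝ)) • allOnes (2 * n) ∨
       A + A * P = (2 * μ / ((2 * n : ℕ) : ℝ)) • allOnes (2 * n))) :
    A.det = 0 ∧ A.rank ≤ n + 1 := by
  obtain ⟨P, ⟨hperm, hsymm, htr⟩, hAP⟩ := htype
  have hP := hperm.mul_self_of_symm hsymm
  have htr0 : P.trace = 0 := by
    rcases htr with h | ⟨hodd, -⟩
    · exact h.2
    · exact absurd hodd (by simp)
  have hrank : A.rank ≤ n + 1 := by
    rcases hAP with h | h
    · exact rank_le_of_add_involution_mul hP htr0 h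
    · rw [← rank_transpose]
      refine rank_le_of_add_involution_mul hP htr0 (c := 2 * μ / ((2 * n : ℕ) : ℝ)) ?_
      have ht := congrArg transpose h
      rw [transpose_add, transpose_mul, ← hsymm, transpose_smul] at ht
      exact ht
  refine ⟨?_, hrank⟩
  obtain rfl | hn1 : n = 1 ∨ 1 < n := by omega
  · exact hA.det_eq_zero_of_order_two
  · by_contra hdet
    rw [rank_of_det_ne_zero hdet, Fintype.card_fin] at hrank
    omega
end
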